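/- arXiv:1511.06446 — 5 statements merged into one kernel-verified Lean document; each statement's English description precedes it below -/
import Mathlib

section
/- For every natural number M there exists a constant C = C(M) > 0 with the following property. Let F be any finite field, let n, m ≤ M, and let P_1, …, P_m ∈ F[x_1, …, x_n] be polynomials each of total degree at most M. Let I be the ideal of F[x_1, …, x_n] generated by P_1, …, P_m, and suppose the Krull dimension of the quotient ring F[x_1, …, x_n]/I equals e (a natural number). Then the number of points x ∈ F^n with P_1(x) = ⋯ = P_m(x) = 0 is at most C · |F|^e. -/
section helpers
open MvPolynomial
open Filter hiding map

lemma count_aux (D n : ℕ) : ∀ r : ℕ, ∃ C : ℕ, ∀ (F : Type) [Field F] [Fintype F]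
    (V : Set (Fin n → F)),
    (∀ S : Finset (Fin n), S.card = r → ∃ f : MvPolynomial (Fin n) F, f ≠ 0 ∧
      (∀ i, degreeOf i f ≤ if i ∈ S then D else 0) ∧ ∀ x ∈ V, eval x f = 0) →
    V.ncard * Fintype.card F ≤ C * Fintype.card F ^ r := by
  have zero : ∀ (n : ℕ) (F : Type) [Field F] [Fintype F]
    (V : Set (Fin n → F)),
    (∀ S : Finset (Fin n), S.card = 0 → ∃ f : MvPolynomial (Fin n) F, f ≠ 0 ∧
      (∀ i, degreeOf i f ≤ if i ∈ S then D else 0) ∧ ∀ x ∈ V, eval x f = 0) → V = ∅ := by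
    intro n F _ _ V h
    obtain ⟨f, hf, hd, hx⟩ := h ∅ rfl
    have : f.vars = ∅ := by
      ext i
      have h1 := hd i
      simp only [Finset.notMem_empty, if_false, degreeOf_le_iff] at h1
      simp only [mem_vars_iff_mem_support, Finset.notMem_empty, iff_false, not_exists, not_and]
      intro d hd
      simpa using h1 d hd
    obtain ⟨c, hc⟩ : ∃ c, f = C c := ⟨_, vars_eq_empty_iff_eq_C.1 this⟩
    subst hc
    rw [Set.eq_empty_iff_forall_notMem]
    intro x hxV
    have := hx x hxV
    simp at this
    simp [this] at hf
  induction n with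
  | zero =>
    intro r
    refine ⟨1, fun F _ _ V h => ?_⟩
    rcases r with _ | r
    · simp [zero 0 F V h]
    · have h1 : V.ncard ≤ 1 := by
        have := Set.ncard_le_one_of_subsingleton V
        exact this
      have h2 : 1 ≤ Fintype.card F ^ r := Nat.one_le_pow _ _ Fintype.card_pos
      rw [pow_succ, one_mul]
      exact Nat.mul_le_mul_right _ (h1.trans h2)
  | succ n ih =>
    intro r
    rcases r with _ | r
    · exact ⟨0, fun F _ _ V h => by simp [zero _ F V h]⟩
    obtain ⟨C1, h1⟩ := ih r
    obtain ⟨C2, h2⟩ := ih (r + 1)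
    refine ⟨C1 + 2 ^ n * D * C2, fun F _ _ V h => ?_⟩
    classical
    choose! f hf0 hfd hfV using h
    set q := Fintype.card F with hq
    let W : F → Set (Fin n → F) := fun a => {x | Fin.cons a x ∈ V}
    let g : F → MvPolynomial (Fin (n + 1)) F → MvPolynomial (Fin n) F := fun a p =>
      (finSuccEquiv F n p).eval (C a)
    have hgd : ∀ a p i, degreeOf i (g a p) ≤ degreeOf i.succ p := by
      intro a p i
      simp only [g, Polynomial.eval_eq_sum, Polynomial.sum]
      refine (degreeOf_sum_le _ _ _).trans (Finset.sup_le fun k _ => ?_)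
      rw [← C_pow, mul_comm]
      exact (degreeOf_C_mul_le _ _ _).trans (degreeOf_coeff_finSuccEquiv _ _ _)
    have hge : ∀ a p x, eval x (g a p) = eval (Fin.cons a x : Fin (n+1) → F) p := by
      intro a p x
      simp only [g]
      rw [eval_eq_eval_mv_eval', Polynomial.eval_map]
      rw [← Polynomial.eval₂_hom]
      simp
    let Bs : Finset (Fin n) → Finset F := fun S =>
      Finset.univ.filter fun a => g a (f (insert 0 (S.map (Fin.succEmb n)))) = 0
    let B : Finset F := (Finset.univ.filter fun S : Finset (Fin n) => S.card = r).biUnion Bs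
    have hins : ∀ S : Finset (Fin n), (insert 0 (S.map (Fin.succEmb n))).card = S.card + 1 := by
      intro S
      rw [Finset.card_insert_of_notMem, Finset.card_map]
      simp [Fin.succ_ne_zero]
    have hB : B.card ≤ 2 ^ n * D := by
      refine (Finset.card_biUnion_le_card_mul _ _ D ?_).trans ?_
      · intro S hS
        have hS' : S.card = r := by simpa using hS
        set p := f (insert 0 (S.map (Fin.succEmb n))) with hp
        have hp0 : p ≠ 0 := hf0 _ (by rw [hins, hS'])
        have hp0' : finSuccEquiv F n p ≠ 0 := by simpa using hp0
        have : ((Bs S).map ⟨(C : F →+* MvPolynomial (Fin n) F), C_injective _ _⟩).val ≤ (finSuccEquiv F n p).roots := by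
          rw [Finset.val_le_iff_val_subset]
          intro y hy
          simp only [Finset.mem_val, Finset.mem_map] at hy
          obtain ⟨a, ha, rfl⟩ := hy
          rw [Polynomial.mem_roots hp0']
          simpa [Bs, g] using ha
        have h3 := Multiset.card_le_card this
        have h4 := Polynomial.card_roots' (finSuccEquiv F n p)
        have h5 := hfd (insert 0 (S.map (Fin.succEmb n))) (by rw [hins, hS']) 0
        rw [natDegree_finSuccEquiv] at h4
        simp at h5 h3
        exact h3.trans (h4.trans h5)
      · gcongr
        refine (Finset.card_filter_le _ _).trans ?_
        simp
    have hgood : ∀ a ∉ B, (W a).ncard * q ≤ C1 * q ^ r := by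
      intro a ha
      refine h1 F (W a) fun S hS => ⟨g a (f (insert 0 (S.map (Fin.succEmb n)))), ?_, ?_, ?_⟩
      · intro h0
        apply ha
        simp only [B, Finset.mem_biUnion]
        exact ⟨S, by simpa using hS, by simpa [Bs] using h0⟩
      · intro i
        refine (hgd _ _ _).trans ((hfd _ (by rw [hins, hS]) _).trans ?_)
        simp [Fin.succ_ne_zero]
      · intro x hx
        rw [hge]
        exact hfV _ (by rw [hins, hS]) _ hx
    have hbad : ∀ a, (W a).ncard * q ≤ C2 * q ^ (r + 1) := by
      intro a
      refine h2 F (W a) fun S hS => ⟨g a (f (S.map (Fin.succEmb n))), ?_, ?_, ?_⟩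
      · have hd := hfd (S.map (Fin.succEmb n)) (by simpa using hS) 0
        have h0 := hf0 (S.map (Fin.succEmb n)) (by simpa using hS)
        simp [Fin.succ_ne_zero] at hd
        rw [← natDegree_finSuccEquiv] at hd
        simp only [g]
        rw [Polynomial.eq_C_of_natDegree_eq_zero hd, Polynomial.eval_C]
        intro h6
        apply h0
        apply (finSuccEquiv F n).injective
        rw [map_zero, Polynomial.eq_C_of_natDegree_eq_zero hd, h6, Polynomial.C_0]
      · intro i
        refine (hgd _ _ _).trans ((hfd _ (by simpa using hS) _).trans ?_)
        simp
      · intro x hx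
        rw [hge]
        exact hfV _ (by simpa using hS) _ hx
    have hV : V.ncard ≤ ∑ a, (W a).ncard := by
      have : V ⊆ ⋃ a ∈ (Finset.univ : Finset F), (fun x => (Fin.cons a x : Fin (n+1) → F)) '' W a := by
        intro x hx
        simp only [Finset.mem_univ, Set.iUnion_true, Set.mem_iUnion]
        exact ⟨x 0, Fin.tail x, by simpa [W] using hx, by simp⟩
      refine (Set.ncard_le_ncard this (Set.toFinite _)).trans ?_
      refine (Finset.set_ncard_biUnion_le _ _).trans ?_
      exact Finset.sum_le_sum fun a _ => Set.ncard_image_le (Set.toFinite _)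
    calc V.ncard * q ≤ (∑ a, (W a).ncard) * q := Nat.mul_le_mul_right _ hV
      _ = ∑ a, (W a).ncard * q := Finset.sum_mul _ _ _
      _ = ∑ a ∈ Bᶜ, (W a).ncard * q + ∑ a ∈ B, (W a).ncard * q := by
        rw [Finset.sum_compl_add_sum]
      _ ≤ ∑ a ∈ Bᶜ, C1 * q ^ r + ∑ a ∈ B, C2 * q ^ (r + 1) := by
        refine add_le_add (Finset.sum_le_sum fun a ha => hgood a (by simpa using ha))
          (Finset.sum_le_sum fun a _ => hbad a)
      _ ≤ q * (C1 * q ^ r) + (2 ^ n * D) * (C2 * q ^ (r + 1)) := by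
        simp only [Finset.sum_const, smul_eq_mul]
        gcongr
        exact Finset.card_le_univ _
      _ = _ := by ring

lemma dim_ge_domain (k A : Type) [Field k] [CommRing A] [IsDomain A] [Algebra k A]
    [Algebra.FiniteType k A] (σ : Type) [Fintype σ] (x : σ → A) (hx : AlgebraicIndependent k x) :
    (Fintype.card σ : WithBot ℕ∞) ≤ ringKrullDim A := by
  obtain ⟨s, g, hg, hi⟩ := exists_integral_inj_algHom_of_fg k A
  let : Algebra (MvPolynomial (Fin s) k) A := g.toRingHom.toAlgebra
  have : IsScalarTower k (MvPolynomial (Fin s) k) A := IsScalarTower.of_algebraMap_eq' (by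
    ext r; exact (g.commutes r).symm)
  have : Algebra.IsIntegral (MvPolynomial (Fin s) k) A := ⟨hi⟩
  have : FaithfulSMul (MvPolynomial (Fin s) k) A := (faithfulSMul_iff_algebraMap_injective _ _).2 hg
  have h1 := trdeg_add_eq k (MvPolynomial (Fin s) k) (A := A)
  rw [MvPolynomial.trdeg_of_isDomain, trdeg_eq_zero, add_zero] at h1
  have h2 := hx.cardinalMk_le_trdeg
  rw [← h1] at h2
  have h3 : Fintype.card σ ≤ s := by simpa using h2
  have h4 : ringKrullDim (MvPolynomial (Fin s) k) = s := by
    rw [MvPolynomial.ringKrullDim_of_isNoetherianRing]; simp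
  have h5 : (s : WithBot ℕ∞) ≤ ringKrullDim A := by
    obtain ⟨l, hl⟩ := Order.le_krullDim_iff.1 (le_of_eq h4.symm)
    obtain ⟨Q, hQ⟩ := Algebra.IsIntegral.comap_surjective (MvPolynomial (Fin s) k) A l.head
    have : Q.asIdeal.LiesOver l.head.asIdeal := ⟨by rw [← hQ]; rfl⟩
    obtain ⟨L, hL, _⟩ := Ideal.exists_ltSeries_of_hasGoingUp (S := A) l Q.asIdeal
    rw [← hl, ← hL]
    exact Order.LTSeries.length_le_krullDim L
  refine le_trans ?_ h5
  exact_mod_cast h3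

lemma dim_ge (k ι : Type) [Field k] [Finite ι] (σ : Type) [Fintype σ] (j : σ → ι)
    (I : Ideal (MvPolynomial ι k)) (h : ∀ g : MvPolynomial σ k, rename j g ∈ I → g = 0) :
    (Fintype.card σ : WithBot ℕ∞) ≤ ringKrullDim (MvPolynomial ι k ⧸ I) := by
  have hinj : Function.Injective ((Ideal.Quotient.mkₐ k I).comp (rename j)) := by
    rw [injective_iff_map_eq_zero]
    intro g hg
    exact h g (Ideal.Quotient.eq_zero_iff_mem.1 hg)
  let T : Submonoid (MvPolynomial ι k) := (nonZeroDivisors (MvPolynomial σ k)).map (rename j)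
  have hT : Disjoint (I : Set (MvPolynomial ι k)) T := by
    rw [Set.disjoint_left]
    rintro _ hI ⟨g, hg, rfl⟩
    exact nonZeroDivisors.ne_zero hg (h g hI)
  obtain ⟨Q, hQ, hIQ, hQT⟩ := Ideal.exists_le_prime_disjoint I T hT
  have hx : AlgebraicIndependent k (fun s => Ideal.Quotient.mkₐ k Q (X (j s))) := by
    rw [algebraicIndependent_iff]
    intro g hg
    by_contra hg0
    have h1 : aeval (fun s => Ideal.Quotient.mkₐ k Q (X (j s))) g = Ideal.Quotient.mkₐ k Q (rename j g) := by
      rw [← AlgHom.comp_apply]; congr 1; ext; simp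
    rw [h1] at hg
    exact Set.disjoint_left.1 hQT (Ideal.Quotient.eq_zero_iff_mem.1 hg)
      ⟨g, mem_nonZeroDivisors_of_ne_zero hg0, rfl⟩
  refine (dim_ge_domain k _ σ _ hx).trans ?_
  exact ringKrullDim_le_of_surjective (Ideal.Quotient.factor hIQ) (Ideal.Quotient.factor_surjective hIQ)

def upIdeal (U : Ultrafilter ℕ) (k : ℕ → Type) [∀ D, Field (k D)] : Ideal (∀ D, k D) where
  carrier := {r | ∀ᶠ D in (U : Filter ℕ), r D = 0}
  add_mem' {a b} ha hb := by
    filter_upwards [ha, hb] with D h1 h2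
    simp [h1, h2]
  zero_mem' := by simp
  smul_mem' c x hx := by
    filter_upwards [hx] with D h1
    simp [h1]

lemma mem_upIdeal (U : Ultrafilter ℕ) (k : ℕ → Type) [∀ D, Field (k D)] (r : ∀ D, k D) :
    r ∈ upIdeal U k ↔ ∀ᶠ D in (U : Filter ℕ), r D = 0 := Iff.rfl

instance upIdeal_max (U : Ultrafilter ℕ) (k : ℕ → Type) [∀ D, Field (k D)] :
    (upIdeal U k).IsMaximal := by
  rw [Ideal.isMaximal_iff]
  constructor
  · intro h
    rw [mem_upIdeal] at h
    obtain ⟨D, hD⟩ := h.exists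
    simp at hD
  · intro J x hJ hx hxJ
    rw [mem_upIdeal] at hx
    have hx' := Ultrafilter.eventually_not.2 hx
    have h1 : (1 : ∀ D, k D) - x * (fun D => (x D)⁻¹) ∈ J := by
      apply hJ
      rw [mem_upIdeal]
      filter_upwards [hx'] with D hD
      simp [hD]
    have := J.add_mem h1 (J.mul_mem_right (fun D => (x D)⁻¹) hxJ)
    simpa using this

abbrev UP (U : Ultrafilter ℕ) (k : ℕ → Type) [∀ D, Field (k D)] : Type :=
  (∀ D, k D) ⧸ upIdeal U k

noncomputable instance UP_field (U : Ultrafilter ℕ) (k : ℕ → Type) [∀ D, Field (k D)] :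
    Field (UP U k) := Ideal.Quotient.field _

lemma UP_algClosed (U : Ultrafilter ℕ) (k : ℕ → Type) [∀ D, Field (k D)]
    [∀ D, IsAlgClosed (k D)] : IsAlgClosed (UP U k) := by
  apply IsAlgClosed.of_exists_root
  intro p hm hirr
  obtain ⟨q, hq, hdeg, hqm⟩ := Polynomial.lifts_and_degree_eq_and_monic
    (f := Ideal.Quotient.mk (upIdeal U k))
    ((Polynomial.mem_lifts _).2 (Polynomial.map_surjective _ Ideal.Quotient.mk_surjective p)) hm
  have h1 : ∀ D, ∃ x : k D, Polynomial.eval x (q.map (Pi.evalRingHom k D)) = 0 := by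
    intro D
    apply IsAlgClosed.exists_root
    rw [hqm.degree_map, hdeg]
    exact hirr.degree_pos.ne'
  choose x hx using h1
  refine ⟨Ideal.Quotient.mk _ x, ?_⟩
  rw [← hq, Polynomial.eval_map, Polynomial.eval₂_hom]
  have : Polynomial.eval x q = 0 := by
    funext D
    have := hx D
    rw [Polynomial.eval_map] at this
    have h2 := Polynomial.eval₂_hom (Pi.evalRingHom k D) x (p := q)
    simp only [Pi.evalRingHom_apply] at h2
    exact h2.symm.trans this
  rw [this, map_zero]

lemma map_mk_eq_zero_iff (U : Ultrafilter ℕ) (k : ℕ → Type) [∀ D, Field (k D)] {ι : Type}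
    (p : MvPolynomial ι (∀ D, k D)) :
    map (Ideal.Quotient.mk (upIdeal U k)) p = 0 ↔
      ∀ᶠ D in (U : Filter ℕ), map (Pi.evalRingHom k D) p = 0 := by
  constructor
  · intro h
    have h1 : ∀ s ∈ p.support, ∀ᶠ D in (U : Filter ℕ), (coeff s p) D = 0 := by
      intro s _
      rw [← mem_upIdeal, ← Ideal.Quotient.eq_zero_iff_mem, ← coeff_map, h, coeff_zero]
    filter_upwards [(eventually_all_finset p.support).2 h1] with D hD
    ext s
    rw [coeff_map, coeff_zero]
    by_cases hs : s ∈ p.support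
    · exact hD s hs
    · rw [notMem_support_iff.1 hs, map_zero]
  · intro h
    ext s
    rw [coeff_map, coeff_zero, Ideal.Quotient.eq_zero_iff_mem, mem_upIdeal]
    filter_upwards [h] with D hD
    have := congrArg (coeff s) hD
    simpa [coeff_map] using this

lemma exists_lift (k : ℕ → Type) [∀ D, Field (k D)] {ι : Type} [Finite ι] (M : ℕ)
    (p : ∀ D, MvPolynomial ι (k D)) (hp : ∀ D, (p D).totalDegree ≤ M) :
    ∃ q : MvPolynomial ι (∀ D, k D), ∀ D, map (Pi.evalRingHom k D) q = p D := by
  classical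
  let B : Finset (ι →₀ ℕ) := Finset.Iic (Finsupp.equivFunOnFinite.symm fun _ => M)
  refine ⟨∑ s ∈ B, monomial s (fun D => coeff s (p D)), fun D => ?_⟩
  rw [map_sum]
  simp only [map_monomial, Pi.evalRingHom_apply]
  refine Eq.trans ?_ (p D).support_sum_monomial_coeff
  symm
  apply Finset.sum_subset
  · intro s hs
    simp only [B, Finset.mem_Iic]
    intro i
    simp only [Finsupp.equivFunOnFinite_symm_apply_apply]
    refine le_trans ?_ (hp D)
    refine le_trans ?_ (le_totalDegree hs)
    by_cases hi : i ∈ s.support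
    · exact Finset.single_le_sum (f := fun i => s i) (fun _ _ => Nat.zero_le _) hi
    · simp [Finsupp.notMem_support_iff.1 hi]
  · intro s _ hs
    rw [notMem_support_iff.1 hs, monomial_zero]

lemma descend (U : Ultrafilter ℕ) (hU : (U : Filter ℕ) ≤ atTop)
    (F : ℕ → Type) [∀ D, Field (F D)] (τ σ : Type) (m : ℕ)
    (Pt : Fin m → MvPolynomial (τ ⊕ σ) (∀ D, F D)) (a : MvPolynomial σ (UP U F)) (ha0 : a ≠ 0)
    (haI : rename Sum.inr a ∈ (Ideal.span (Set.range Pt)).map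
      (map (Ideal.Quotient.mk (upIdeal U F)))) :
    ∃ D, ∃ g : MvPolynomial σ (F D), g ≠ 0 ∧ g.totalDegree ≤ D ∧
      rename Sum.inr g ∈ Ideal.span (Set.range fun i => map (Pi.evalRingHom F D) (Pt i)) := by
  obtain ⟨b, hb⟩ := map_surjective (Ideal.Quotient.mk (upIdeal U F))
    Ideal.Quotient.mk_surjective a
  rw [← hb] at ha0 haI
  obtain ⟨p, hpI, hp⟩ := (Ideal.mem_map_iff_of_surjective _
    (map_surjective (Ideal.Quotient.mk (upIdeal U F)) Ideal.Quotient.mk_surjective)).1 haI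
  have h1 : map (Ideal.Quotient.mk (upIdeal U F)) (p - rename Sum.inr b) = 0 := by
    rw [map_sub, hp, map_rename, sub_self]
  rw [map_mk_eq_zero_iff] at h1
  have h2 : ∀ᶠ D in (U : Filter ℕ), ¬ map (Pi.evalRingHom F D) b = 0 := by
    rw [Ultrafilter.eventually_not, ← map_mk_eq_zero_iff]
    exact ha0
  have h3 : ∀ᶠ D in (U : Filter ℕ), b.totalDegree ≤ D := hU (eventually_ge_atTop _)
  obtain ⟨D, h1, h2, h3⟩ := (h1.and (h2.and h3)).exists
  refine ⟨D, _, h2, ?_, ?_⟩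
  · refine le_trans ?_ h3
    exact Finset.sup_mono (support_map_subset _ _)
  · rw [map_sub, sub_eq_zero, map_rename] at h1
    rw [← h1]
    have := Ideal.mem_map_of_mem (map (Pi.evalRingHom F D)) hpI
    rw [Ideal.map_span, ← Set.range_comp] at this
    exact this

lemma key (F k : ℕ → Type) [∀ D, Field (F D)] [∀ D, Field (k D)] [∀ D, IsAlgClosed (k D)]
    [∀ D, Algebra (F D) (k D)] (τ σ : Type) [Finite τ] [Finite σ] (m M : ℕ)
    (x : ∀ D, σ → k D) (hx : ∀ D, AlgebraicIndependent (F D) (x D))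
    (P : ∀ D, Fin m → MvPolynomial (τ ⊕ σ) (F D)) (hP : ∀ D i, (P D i).totalDegree ≤ M)
    (hn : ∀ D, ∀ y : τ → k D, ∃ i, aeval (Sum.elim y (x D)) (P D i) ≠ 0) :
    ∃ D, ∃ g : MvPolynomial σ (F D), g ≠ 0 ∧ g.totalDegree ≤ D ∧
      rename Sum.inr g ∈ Ideal.span (Set.range (P D)) := by
  let U : Ultrafilter ℕ := hyperfilter ℕ
  have hlift : ∀ i, ∃ q : MvPolynomial (τ ⊕ σ) (∀ D, F D),
      ∀ D, map (Pi.evalRingHom F D) q = P D i := fun i =>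
    exists_lift F M (fun D => P D i) (fun D => hP D i)
  choose Pt hPt using hlift
  let mkF := Ideal.Quotient.mk (upIdeal U F)
  let mkk := Ideal.Quotient.mk (upIdeal U k)
  let inc : (∀ D, F D) →+* (∀ D, k D) :=
    RingHom.pi fun D => (algebraMap (F D) (k D)).comp (Pi.evalRingHom F D)
  let incU : UP U F →+* UP U k := Ideal.quotientMap (upIdeal U k) inc (by
    intro r hr
    rw [Ideal.mem_comap, mem_upIdeal]
    filter_upwards [(mem_upIdeal U F r).1 hr] with D hD
    change algebraMap (F D) (k D) (r D) = 0
    rw [hD, map_zero])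
  have hincU : ∀ r, incU (mkF r) = mkk (inc r) := fun r => rfl
  -- evaluation compatibility
  have hev : ∀ (ι : Type) (y : ∀ D, ι → k D) (p : MvPolynomial ι (∀ D, F D)),
      eval₂ incU (fun i => mkk fun D => y D i) (map mkF p) =
        mkk (fun D => aeval (y D) (map (Pi.evalRingHom F D) p)) := by
    intro ι y p
    let φ1 : MvPolynomial ι (∀ D, F D) →+* UP U k :=
      (eval₂Hom incU (fun i => mkk fun D => y D i)).comp (map mkF)
    let φ2 : MvPolynomial ι (∀ D, F D) →+* UP U k :=
      mkk.comp (RingHom.pi fun D => (aeval (y D)).toRingHom.comp (map (Pi.evalRingHom F D)))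
    have : φ1 = φ2 := by
      apply MvPolynomial.ringHom_ext
      · intro r
        simp only [φ1, φ2, RingHom.comp_apply, map_C, coe_eval₂Hom, eval₂_C, hincU]
        congr 1
        funext D
        change algebraMap (F D) (k D) (r D) = aeval (y D) (map (Pi.evalRingHom F D) (C r))
        simp
      · intro i
        simp only [φ1, φ2, RingHom.comp_apply, map_X, coe_eval₂Hom, eval₂_X]
        congr 1
        funext D
        change _ = aeval (y D) (map (Pi.evalRingHom F D) (X i))
        simp
    exact congrArg (fun φ : MvPolynomial ι (∀ D, F D) →+* UP U k => φ p) this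
  let A := MvPolynomial σ (UP U F)
  let φ : A →+* UP U k := eval₂Hom incU (fun i => mkk fun D => x D i)
  have hφ : Function.Injective φ := by
    rw [injective_iff_map_eq_zero]
    intro f hf
    obtain ⟨f, rfl⟩ := map_surjective mkF Ideal.Quotient.mk_surjective f
    have h1 := hev σ x f
    rw [show eval₂ incU (fun i => mkk fun D => x D i) (map mkF f) = 0 from hf] at h1
    have h2 := (mem_upIdeal U k _).1 (Ideal.Quotient.eq_zero_iff_mem.1 h1.symm)
    rw [map_mk_eq_zero_iff]
    filter_upwards [h2] with D hD
    exact (algebraicIndependent_iff.1 (hx D)) _ hD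
  let L := FractionRing A
  let incL : L →+* UP U k := IsFractionRing.lift hφ
  have hincL : ∀ a : A, incL (algebraMap A L a) = φ a := fun a => IsFractionRing.lift_algebraMap hφ a
  let _ : Algebra L (UP U k) := incL.toAlgebra
  have : IsAlgClosed (UP U k) := UP_algClosed U k
  let I : Ideal (MvPolynomial (τ ⊕ σ) (∀ D, F D)) := Ideal.span (Set.range Pt)
  let e := sumRingEquiv (UP U F) τ σ
  let J : Ideal (MvPolynomial τ A) := (I.map (map mkF)).map (e : MvPolynomial (τ ⊕ σ) (UP U F) →+* MvPolynomial τ A)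
  let J' : Ideal (MvPolynomial τ L) := J.map (map (algebraMap A L))
  have hJ' : J' = ⊤ := by
    by_contra hne
    obtain ⟨m, hm, hJm⟩ := Ideal.exists_le_maximal J' hne
    obtain ⟨y, hy⟩ := eq_vanishingIdeal_singleton_of_isMaximal (UP U k) hm
    have hyt : ∀ t, ∃ z : ∀ D, k D, mkk z = y t := fun t => Ideal.Quotient.mk_surjective (y t)
    choose z hz using hyt
    have h0 : ∀ i, ∀ᶠ D in (U : Filter ℕ),
        aeval (Sum.elim (fun t => z t D) (x D)) (P D i) = 0 := by
      intro i
      have h1 : map (algebraMap A L) (e (map mkF (Pt i))) ∈ m := by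
        apply hJm
        apply Ideal.mem_map_of_mem
        apply Ideal.mem_map_of_mem (e : MvPolynomial (τ ⊕ σ) (UP U F) →+* MvPolynomial τ A)
        apply Ideal.mem_map_of_mem
        exact Ideal.subset_span ⟨i, rfl⟩
      rw [hy, mem_vanishingIdeal_singleton_iff] at h1
      have h2 := hev (τ ⊕ σ) (fun D => Sum.elim (fun t => z t D) (x D)) (Pt i)
      have h3 : ∀ p : MvPolynomial (τ ⊕ σ) (UP U F),
          aeval y (map (algebraMap A L) (e p)) =
          eval₂ incU (fun i => mkk fun D => Sum.elim (fun t => z t D) (x D) i) p := by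
        intro p
        let φ1 : MvPolynomial (τ ⊕ σ) (UP U F) →+* UP U k :=
          ((aeval y).toRingHom.comp (map (algebraMap A L))).comp (e : _ →+* _)
        let φ2 : MvPolynomial (τ ⊕ σ) (UP U F) →+* UP U k :=
          eval₂Hom incU (fun i => mkk fun D => Sum.elim (fun t => z t D) (x D) i)
        have : φ1 = φ2 := by
          apply MvPolynomial.ringHom_ext
          · intro r
            have : φ1 (C r) = incL (algebraMap A L (C r)) := by
              simp [φ1, e]
              rfl
            rw [this, hincL]
            exact (eval₂_C incU _ r).trans (eval₂_C incU _ r).symm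
          · rintro (t | s)
            · simp [φ1, φ2, e, ← hz]
            · have : φ1 (X (Sum.inr s)) = incL (algebraMap A L (X s)) := by
                simp [φ1, e]
                rfl
              rw [this, hincL]
              refine (eval₂_X incU _ s).trans ?_
              symm
              exact eval₂_X incU (fun i => mkk fun D => Sum.elim (fun t => z t D) (x D) i) (Sum.inr s)
        exact congrArg (fun φ : MvPolynomial (τ ⊕ σ) (UP U F) →+* UP U k => φ p) this
      rw [← h3, h1] at h2
      have h4 := (mem_upIdeal U k _).1 (Ideal.Quotient.eq_zero_iff_mem.1 h2.symm)
      filter_upwards [h4] with D hD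
      rwa [hPt] at hD
    obtain ⟨D, hD⟩ := (eventually_all.2 h0).exists
    obtain ⟨i, hi⟩ := hn D (fun t => z t D)
    exact hi (hD i)
  -- extract
  obtain ⟨a, ha0, haJ⟩ : ∃ a : A, a ≠ 0 ∧ C a ∈ J := by
    by_contra hno
    push Not at hno
    have hd : Disjoint (((nonZeroDivisors A).map (C (σ := τ)) : Submonoid (MvPolynomial τ A)) : Set (MvPolynomial τ A)) J := by
      rw [Set.disjoint_left]
      rintro _ ⟨a, ha, rfl⟩ haJ
      exact hno a (nonZeroDivisors.ne_zero ha) haJ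
    let _ : Algebra (MvPolynomial τ A) (MvPolynomial τ L) := MvPolynomial.algebraMvPolynomial
    exact (IsLocalization.map_algebraMap_ne_top_iff_disjoint ((nonZeroDivisors A).map (C (σ := τ)))
      (MvPolynomial τ L) J).2 hd hJ'
  have haI : rename Sum.inr a ∈ I.map (map mkF) := by
    have h1 : e (rename Sum.inr a) = C a := by
      let φ1 : A →+* MvPolynomial τ A := (e : MvPolynomial (τ ⊕ σ) (UP U F) →+* MvPolynomial τ A).comp
        (rename Sum.inr).toRingHom
      have : φ1 = C := by
        apply MvPolynomial.ringHom_ext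
        · intro r
          simp [φ1, e]
        · intro i
          simp [φ1, e]
      exact congrArg (fun φ : A →+* MvPolynomial τ A => φ a) this
    rw [← h1] at haJ
    obtain ⟨b, hb, hbe⟩ := (Ideal.mem_map_iff_of_surjective
      (e : MvPolynomial (τ ⊕ σ) (UP U F) →+* MvPolynomial τ A) e.surjective).1 haJ
    rwa [← e.injective hbe]
  obtain ⟨D, g, hg0, hgd, hg⟩ := descend U Nat.hyperfilter_le_atTop F τ σ m Pt a ha0 haI
  refine ⟨D, g, hg0, hgd, ?_⟩
  simpa only [hPt] using hg

lemma elim_bound (n m M : ℕ) (S : Finset (Fin n)) : ∃ D : ℕ, ∀ (F : Type) [Field F]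
    (P : Fin m → MvPolynomial (Fin n) F), (∀ i, (P i).totalDegree ≤ M) →
    (∃ g : MvPolynomial {i // i ∈ S} F, g ≠ 0 ∧
      rename Subtype.val g ∈ Ideal.span (Set.range P)) →
    ∃ g : MvPolynomial {i // i ∈ S} F, g ≠ 0 ∧ g.totalDegree ≤ D ∧
      rename Subtype.val g ∈ Ideal.span (Set.range P) := by
  by_contra hno
  have hno' : ∀ D : ℕ, ∃ (F : Type) (_ : Field F) (P : Fin m → MvPolynomial (Fin n) F)
      (g : MvPolynomial {i // i ∈ S} F), (∀ i, (P i).totalDegree ≤ M) ∧ g ≠ 0 ∧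
      rename Subtype.val g ∈ Ideal.span (Set.range P) ∧
      ∀ g' : MvPolynomial {i // i ∈ S} F, g' ≠ 0 → g'.totalDegree ≤ D →
        rename Subtype.val g' ∉ Ideal.span (Set.range P) := by
    intro D
    by_contra hc
    refine hno ⟨D, fun F _ P hP hg => ?_⟩
    obtain ⟨g, hg0, hg⟩ := hg
    by_contra hc2
    exact hc ⟨F, _, P, g, hP, hg0, hg, fun g' h1 h2 h3 => hc2 ⟨g', h1, h2, h3⟩⟩
  choose F inst P g hP hg0 hg hbad using hno'
  let τ := {i : Fin n // ¬ i ∈ S}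
  let σ := {i : Fin n // i ∈ S}
  let e : Fin n ≃ τ ⊕ σ := (Equiv.sumCompl (fun i => i ∈ S)).symm.trans (Equiv.sumComm _ _)
  have hes : ∀ s : σ, e s.1 = Sum.inr s := by
    intro s
    simp [e, s.2]
  let k : ℕ → Type := fun D => AlgebraicClosure (FractionRing (MvPolynomial σ (F D)))
  let x : ∀ D, σ → k D := fun D s =>
    algebraMap (FractionRing (MvPolynomial σ (F D))) (k D) (algebraMap (MvPolynomial σ (F D)) _ (X s))
  have hx : ∀ D, AlgebraicIndependent (F D) (x D) := by
    intro D
    have h1 : ∀ p : MvPolynomial σ (F D), aeval (x D) p =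
        algebraMap (FractionRing (MvPolynomial σ (F D))) (k D) (algebraMap (MvPolynomial σ (F D)) _ p) := by
      intro p
      let φ : MvPolynomial σ (F D) →ₐ[F D] k D :=
        (IsScalarTower.toAlgHom (F D) (FractionRing (MvPolynomial σ (F D))) (k D)).comp
          (IsScalarTower.toAlgHom (F D) (MvPolynomial σ (F D)) _)
      have : aeval (x D) = φ := by
        ext s
        simp [φ, x]
      rw [this]
      rfl
    rw [algebraicIndependent_iff]
    intro p hp
    rw [h1] at hp
    rw [map_eq_zero] at hp
    exact (IsFractionRing.to_map_eq_zero_iff).1 hp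
  obtain ⟨D, h, h0, hd, hh⟩ := key F k τ σ m M x hx (fun D i => rename e (P D i))
    (fun D i => (totalDegree_rename_le _ _).trans (hP D i)) (by
      intro D y
      by_contra hall
      push Not at hall
      have h1 : Ideal.span (Set.range (P D)) ≤
          RingHom.ker (aeval (R := F D) (Sum.elim y (x D) ∘ e)) := by
        rw [Ideal.span_le]
        rintro _ ⟨i, rfl⟩
        have := hall i
        rw [aeval_rename] at this
        exact this
      have h2 := h1 (hg D)
      rw [RingHom.mem_ker, aeval_rename] at h2
      have h3 : (Sum.elim y (x D) ∘ e) ∘ Subtype.val = x D := by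
        funext s
        simp only [Function.comp_apply]
        rw [hes s]
        rfl
      rw [h3] at h2
      exact hg0 D ((algebraicIndependent_iff.1 (hx D)) _ h2))
  refine hbad D h h0 hd ?_
  have h1 := Ideal.mem_map_of_mem (rename (R := F D) e.symm) hh
  rw [Ideal.map_span, ← Set.range_comp, rename_rename] at h1
  have ha : (e.symm ∘ Sum.inr : σ → Fin n) = Subtype.val := by
    funext s
    simp only [Function.comp_apply]
    rw [← hes s, Equiv.symm_apply_apply]
  have hb : ((rename (R := F D) e.symm) ∘ fun i => rename e (P D i)) = P D := by
    funext i
    simp [rename_rename]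
  rw [ha, hb] at h1
  exact h1

lemma bound_nmr (M n m r : ℕ) : ∃ C : ℕ, ∀ (F : Type) [Field F] [Fintype F]
    (P : Fin m → MvPolynomial (Fin n) F), (∀ i, (P i).totalDegree ≤ M) →
    ringKrullDim (MvPolynomial (Fin n) F ⧸ Ideal.span (Set.range P)) = r →
    Set.ncard {x : Fin n → F | ∀ i, MvPolynomial.eval x (P i) = 0} ≤ C * Fintype.card F ^ r := by
  choose D hD using elim_bound n m M
  obtain ⟨C, hC⟩ := count_aux (Finset.univ.sup D) n (r + 1)
  refine ⟨C, fun F _ _ P hP hr => ?_⟩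
  have := hC F {x : Fin n → F | ∀ i, MvPolynomial.eval x (P i) = 0} (by
    intro S hS
    have h1 : ∃ g : MvPolynomial {i // i ∈ S} F, g ≠ 0 ∧
      rename Subtype.val g ∈ Ideal.span (Set.range P) := by
      by_contra hno
      push Not at hno
      have h2 := dim_ge F (Fin n) {i // i ∈ S} Subtype.val (Ideal.span (Set.range P))
        (fun g hg => by
          by_contra h0
          exact hno g h0 hg)
      rw [hr, Fintype.card_coe, hS] at h2
      have h3 : r + 1 ≤ r := by exact_mod_cast h2
      omega
    obtain ⟨g, hg0, hgd, hg⟩ := hD S F P hP h1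
    refine ⟨rename Subtype.val g, ?_, ?_, ?_⟩
    · intro h
      exact hg0 ((rename_injective _ Subtype.val_injective) (by rw [h, map_zero]))
    · intro i
      split_ifs with hi
      · refine (degreeOf_le_totalDegree _ _).trans ((totalDegree_rename_le _ _).trans
          (hgd.trans ?_))
        exact Finset.le_sup (Finset.mem_univ S)
      · classical
        rw [degreeOf_le_iff]
        intro d hd
        by_contra hne
        have : i ∈ (rename Subtype.val g).vars := by
          rw [mem_vars_iff_mem_support]
          exact ⟨d, hd, by simpa using hne⟩
        have := vars_rename _ _ this
        simp at this
        exact hi this.1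
    · intro x hx
      have h1 : Ideal.span (Set.range P) ≤ RingHom.ker (eval x) := by
        rw [Ideal.span_le]
        rintro _ ⟨i, rfl⟩
        exact hx i
      exact h1 hg)
  rw [pow_succ, ← mul_assoc] at this
  exact Nat.le_of_mul_le_mul_right this Fintype.card_pos

end helpers

/-- Lang–Weil type bound: for every complexity bound `M` there is a constant `C > 0`
such that any affine variety over a finite field `F`, cut out by `m ≤ M` polynomials
of total degree at most `M` in `n ≤ M` variables, whose coordinate ring has Krull
dimension `e`, has at most `C * |F| ^ e` points over `F`. -/
theorem lang_weil_bound (M : ℕ) :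
    ∃ C : ℝ, 0 < C ∧
      ∀ (F : Type) [Field F] [Fintype F] (n m : ℕ), n ≤ M → m ≤ M →
        ∀ P : Fin m → MvPolynomial (Fin n) F,
          (∀ i, (P i).totalDegree ≤ M) →
          ∀ e : ℕ,
            ringKrullDim (MvPolynomial (Fin n) F ⧸ Ideal.span (Set.range P)) = e →
            (Set.ncard {x : Fin n → F | ∀ i, MvPolynomial.eval x (P i) = 0} : ℝ) ≤
              C * (Fintype.card F : ℝ) ^ e := by
  classical
  choose C hC using bound_nmr M
  let K : ℕ := ∑ n ∈ Finset.range (M + 1), ∑ m ∈ Finset.range (M + 1),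
    ∑ r ∈ Finset.range (M + 1), C n m r
  refine ⟨(K + 1 : ℕ), by positivity, fun F _ _ n m hn hm P hP e he => ?_⟩
  have hq : 1 ≤ Fintype.card F := Fintype.card_pos
  suffices h : Set.ncard {x : Fin n → F | ∀ i, MvPolynomial.eval x (P i) = 0} ≤
      (K + 1) * Fintype.card F ^ e by exact_mod_cast h
  by_cases heM : e ≤ M
  · refine (hC n m e F P hP he).trans (Nat.mul_le_mul_right _ ?_)
    have h1 : C n m e ≤ ∑ r ∈ Finset.range (M + 1), C n m r :=
      Finset.single_le_sum (f := fun r => C n m r) (fun _ _ => Nat.zero_le _)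
        (Finset.mem_range.2 (by omega))
    have h2 := Finset.single_le_sum (f := fun m => ∑ r ∈ Finset.range (M + 1), C n m r)
      (fun _ _ => Nat.zero_le _) (Finset.mem_range.2 (Nat.lt_succ_of_le hm))
    have h3 := Finset.single_le_sum (f := fun n => ∑ m ∈ Finset.range (M + 1),
      ∑ r ∈ Finset.range (M + 1), C n m r)
      (fun _ _ => Nat.zero_le _) (Finset.mem_range.2 (Nat.lt_succ_of_le hn))
    exact (h1.trans (h2.trans h3)).trans (Nat.le_succ _)
  · have h1 : Set.ncard {x : Fin n → F | ∀ i, MvPolynomial.eval x (P i) = 0} ≤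
        Fintype.card F ^ n := by
      refine (Set.ncard_le_ncard (Set.subset_univ _) (Set.toFinite _)).trans ?_
      rw [Set.ncard_univ, Nat.card_eq_fintype_card]
      simp
    refine h1.trans ((Nat.pow_le_pow_right hq (show n ≤ e by omega)).trans ?_)
    exact Nat.le_mul_of_pos_left _ (Nat.succ_pos _)
end

section
/- Let P_1, …, P_m ∈ ℤ[x_1, …, x_n] be polynomials, let I be the ideal of ℚ[x_1, …, x_n] generated by the images of P_1, …, P_m under coefficient extension ℤ → ℚ, and suppose the Krull dimension of ℚ[x_1, …, x_n]/I equals e (a natural number). Then there exists a constant C > 0 such that for every integer H ≥ 1, the number of integer points x ∈ ℤ^n with |x_i| ≤ H for all i and P_1(x) = ⋯ = P_m(x) = 0 is at most C · H^e. -/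
open MvPolynomial in
theorem aux_dim_le {R S : Type*} [CommRing R] [CommRing S] [Algebra R S]
    [Algebra.IsIntegral R S] [FaithfulSMul R S] : ringKrullDim R ≤ ringKrullDim S := by
  refine iSup_le fun l => ?_
  obtain ⟨⟨P, hP, hlo⟩⟩ := Ideal.nonempty_primesOver (S := S) (RelSeries.head l).asIdeal
  obtain ⟨L, hL, -⟩ := Ideal.exists_ltSeries_of_hasGoingUp l P
  rw [← hL]
  exact le_iSup (fun l : LTSeries (PrimeSpectrum S) => ((l.length : ℕ∞) : WithBot ℕ∞)) L

theorem aux_trdeg_le {A : Type} [CommRing A] [IsDomain A] [Algebra ℚ A]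
    [Algebra.FiniteType ℚ A] (e : ℕ) (h : ringKrullDim A ≤ e) :
    Algebra.trdeg ℚ A ≤ e := by
  obtain ⟨s, g, hg, hi⟩ := exists_integral_inj_algHom_of_fg ℚ A
  algebraize [g.toRingHom]
  have hinj : Function.Injective (algebraMap (MvPolynomial (Fin s) ℚ) A) := hg
  have : FaithfulSMul (MvPolynomial (Fin s) ℚ) A :=
    (faithfulSMul_iff_algebraMap_injective _ _).mpr hinj
  have : Algebra.IsIntegral (MvPolynomial (Fin s) ℚ) A := ⟨hi⟩
  have hs := aux_dim_le (R := MvPolynomial (Fin s) ℚ) (S := A)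
  rw [MvPolynomial.ringKrullDim_of_isNoetherianRing, ringKrullDim_eq_zero_of_field] at hs
  have h2 := hs.trans h
  simp only [Nat.card_eq_fintype_card, Fintype.card_fin, zero_add] at h2
  have h3 : s ≤ e := by exact_mod_cast h2
  have := (IsTranscendenceBasis.mvPolynomial (Fin s) ℚ).algebraMap_comp (A := A)
  rw [← this.cardinalMk_eq_trdeg]
  simpa using h3

open MvPolynomial in
theorem aux_struct {A : Type} [CommRing A] [IsDomain A] [Algebra ℚ A] (n e : ℕ)
    (π : MvPolynomial (Fin n) ℚ →ₐ[ℚ] A) (hπ : Function.Surjective π)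
    (h : ringKrullDim A ≤ e) :
    ∃ (ι : Type) (_ : Fintype ι) (u : ι → Fin n) (F : Fin n → Polynomial (MvPolynomial ι ℚ)),
      Fintype.card ι ≤ e ∧ ∀ j, rename u (F j).leadingCoeff ∉ RingHom.ker π ∧
        ((F j).map (rename u : MvPolynomial ι ℚ →ₐ[ℚ] _).toRingHom).eval (X j) ∈ RingHom.ker π := by
  have : Algebra.FiniteType ℚ A := Algebra.FiniteType.of_surjective π hπ
  let v : Fin n → A := fun i => π (X i)
  have htop : Algebra.adjoin ℚ (Set.range v) = ⊤ := by
    have : Set.range v = π '' Set.range X := by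
      rw [← Set.range_comp]; rfl
    rw [this, ← AlgHom.map_adjoin, adjoin_range_X, Algebra.map_top]
    exact (AlgHom.range_eq_top π).mpr hπ
  have : Algebra.IsAlgebraic (Algebra.adjoin ℚ (Set.range v)) A := by
    have := Algebra.isIntegral_of_surjective (R := Algebra.adjoin ℚ (Set.range v)) (B := A)
      (fun a => ⟨⟨a, by rw [htop]; trivial⟩, rfl⟩)
    exact Algebra.IsIntegral.isAlgebraic
  obtain ⟨t, hts, ht⟩ := exists_isTranscendenceBasis_subset (R := ℚ) (Set.range v)
  have hfin : t.Finite := (Set.finite_range v).subset hts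
  have : Fintype t := hfin.fintype
  choose u hu using fun a : t => hts a.2
  have hcomp : (aeval (Subtype.val : t → A) : MvPolynomial t ℚ →ₐ[ℚ] A) = π.comp (rename u) := by
    ext a
    simp only [aeval_X, AlgHom.comp_apply, rename_X]
    exact (hu a).symm
  have hcard : Fintype.card t ≤ e := by
    have := aux_trdeg_le e h
    rw [← ht.cardinalMk_eq_trdeg] at this
    simpa using this
  have halg := ht.isAlgebraic
  have key : ∀ j, ∃ F : Polynomial (MvPolynomial t ℚ), rename u F.leadingCoeff ∉ RingHom.ker π ∧
        (F.map (rename u : MvPolynomial t ℚ →ₐ[ℚ] _).toRingHom).eval (X j) ∈ RingHom.ker π := by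
    intro j
    obtain ⟨f, hf0, hf⟩ := halg.isAlgebraic (v j)
    let E := ht.1.aevalEquiv
    refine ⟨f.map E.symm.toRingEquiv.toRingHom, ?_, ?_⟩
    · intro hmem
      have h0 : π (rename u (f.map E.symm.toRingEquiv.toRingHom).leadingCoeff) = 0 :=
        hmem
      rw [← AlgHom.comp_apply, ← hcomp] at h0
      have := ht.1.eq_zero_of_aeval_eq_zero _ h0
      rw [Polynomial.leadingCoeff_eq_zero] at this
      exact hf0 ((Polynomial.map_eq_zero_iff E.symm.toRingEquiv.injective).mp this)
    · change π.toRingHom _ = 0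
      rw [← Polynomial.eval₂_at_apply, Polynomial.eval₂_map, Polynomial.eval₂_map]
      rw [← hf, Polynomial.aeval_def]
      congr 1
      ext a
      obtain ⟨b, rfl⟩ := E.surjective a
      have := congrArg (fun φ => φ b) hcomp
      simp only [AlgHom.comp_apply] at this
      simp
      rw [← this]
      exact (ht.1.algebraMap_aevalEquiv b).symm
  choose F hF using key
  exact ⟨t, inferInstance, u, F, hcard, hF⟩

/-- Integer points of height at most `H` on the zero set of `I`. -/
def auxZ {n : ℕ} (I : Ideal (MvPolynomial (Fin n) ℚ)) (H : ℤ) : Set (Fin n → ℤ) :=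
  {x | (∀ i, |x i| ≤ H) ∧ ∀ f ∈ I, MvPolynomial.eval (fun i => (x i : ℚ)) f = 0}

theorem auxZ_finite {n : ℕ} (I : Ideal (MvPolynomial (Fin n) ℚ)) (H : ℤ) : (auxZ I H).Finite := by
  refine (Fintype.piFinset fun _ : Fin n => Finset.Icc (-H) H).finite_toSet.subset ?_
  intro x hx
  simp only [Finset.mem_coe, Fintype.mem_piFinset, Finset.mem_Icc, ← abs_le]
  exact hx.1

open MvPolynomial in
theorem aux_good {n e : ℕ} {ι : Type} [Fintype ι] (u : ι → Fin n)
    (F : Fin n → Polynomial (MvPolynomial ι ℚ)) (hc : Fintype.card ι ≤ e) (H : ℤ) (hH : 1 ≤ H)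
    (G : Set (Fin n → ℤ)) (hG : ∀ x ∈ G, ∀ i, |x i| ≤ H)
    (h1 : ∀ x ∈ G, ∀ j, eval (fun i => (x i : ℚ)) (rename u (F j).leadingCoeff) ≠ 0)
    (h2 : ∀ x ∈ G, ∀ j, eval (fun i => (x i : ℚ))
      (((F j).map (rename u : MvPolynomial ι ℚ →ₐ[ℚ] _).toRingHom).eval (X j)) = 0) :
    (G.ncard : ℝ) ≤ ((∏ j, (F j).natDegree : ℕ) * 3 ^ e : ℝ) * (H : ℝ) ^ e := by
  classical
  let B : Finset (ι → ℤ) := Fintype.piFinset fun _ : ι => Finset.Icc (-H) H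
  let T : (ι → ℤ) → Finset (Fin n → ℚ) := fun y =>
    Fintype.piFinset fun j => ((F j).map (eval fun i => (y i : ℚ))).roots.toFinset
  have hT : ∀ y ∈ B, (T y).card ≤ ∏ j, (F j).natDegree := by
    intro y _
    rw [Fintype.card_piFinset]
    refine Finset.prod_le_prod' fun j _ => ?_
    exact (Multiset.toFinset_card_le _).trans
      ((Polynomial.card_roots' _).trans Polynomial.natDegree_map_le)
  have hle : G.ncard ≤ (B.biUnion T).card := by
    rw [← Set.ncard_coe_finset]
    refine Set.ncard_le_ncard_of_injOn (fun x i => (x i : ℚ)) ?_ ?_ (Finset.finite_toSet _)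
    · intro x hx
      simp only [Finset.mem_coe, Finset.mem_biUnion]
      refine ⟨x ∘ u, ?_, ?_⟩
      · simp only [B, Fintype.mem_piFinset, Finset.mem_Icc, ← abs_le]
        exact fun i => hG x hx _
      · simp only [T, Fintype.mem_piFinset, Multiset.mem_toFinset]
        intro j
        have e1 := h1 x hx j
        have e2 := h2 x hx j
        rw [eval_rename] at e1
        have hne : (F j).map (eval fun i => ((x ∘ u) i : ℚ)) ≠ 0 := by
          intro h0
          apply e1
          have := congrArg (fun q => Polynomial.coeff q (F j).natDegree) h0
          simpa [Polynomial.coeff_map, Function.comp_def] using this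
        rw [Polynomial.mem_roots hne, Polynomial.IsRoot, Polynomial.eval_map]
        rw [← Polynomial.eval₂_at_apply, Polynomial.eval₂_map, eval_X] at e2
        rw [← e2]
        congr 1
        ext a
        · simp
        · simp
    · intro x _ y _ hxy
      funext i
      have := congrFun hxy i
      simpa using this
  have hcard : (B.biUnion T).card ≤ (2 * H + 1).toNat ^ Fintype.card ι * ∏ j, (F j).natDegree := by
    refine (Finset.card_biUnion_le_card_mul _ _ _ hT).trans (le_of_eq ?_)
    congr 1
    rw [Fintype.card_piFinset]
    simp only [Int.card_Icc, Finset.prod_const, Finset.card_univ]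
    congr 2
    ring
  have h3 : (((2 * H + 1).toNat : ℕ) : ℝ) ≤ 3 * H := by
    have : ((2 * H + 1).toNat : ℤ) ≤ 3 * H := by omega
    exact_mod_cast this
  have hHR : (1 : ℝ) ≤ H := by exact_mod_cast hH
  calc (G.ncard : ℝ) ≤ ((2 * H + 1).toNat ^ Fintype.card ι * ∏ j, (F j).natDegree : ℕ) := by
        exact_mod_cast hle.trans hcard
    _ = ((2 * H + 1).toNat : ℝ) ^ Fintype.card ι * ((∏ j, (F j).natDegree : ℕ) : ℝ) := by
        push_cast; rfl
    _ ≤ (3 * H : ℝ) ^ e * ((∏ j, (F j).natDegree : ℕ) : ℝ) := by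
        gcongr
        calc ((2 * H + 1).toNat : ℝ) ^ Fintype.card ι ≤ (3 * H : ℝ) ^ Fintype.card ι := by gcongr
          _ ≤ _ := pow_le_pow_right₀ (by linarith) hc
    _ = _ := by rw [mul_pow]; ring

theorem aux_mono {R : Type*} [CommRing R] {I J : Ideal R} (h : I ≤ J) {e : ℕ}
    (hd : ringKrullDim (R ⧸ I) ≤ e) : ringKrullDim (R ⧸ J) ≤ e :=
  (ringKrullDim_le_of_surjective (Ideal.Quotient.factor h)
    (Ideal.Quotient.factor_surjective h)).trans hd

theorem auxZ_sup {n : ℕ} {I : Ideal (MvPolynomial (Fin n) ℚ)} {a : MvPolynomial (Fin n) ℚ} {H : ℤ}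
    {x : Fin n → ℤ} (hx : x ∈ auxZ I H) (ha : MvPolynomial.eval (fun i => (x i : ℚ)) a = 0) :
    x ∈ auxZ (I ⊔ Ideal.span {a}) H := by
  refine ⟨hx.1, ?_⟩
  have : I ⊔ Ideal.span {a} ≤ RingHom.ker (MvPolynomial.eval (fun i => (x i : ℚ))) := by
    rw [sup_le_iff, Ideal.span_singleton_le_iff_mem]
    exact ⟨fun f hf => hx.2 f hf, ha⟩
  exact fun f hf => this hf

theorem aux_lt {R : Type*} [CommRing R] {I : Ideal R} {a : R} (ha : a ∉ I) :
    I < I ⊔ Ideal.span {a} := by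
  refine lt_of_le_of_ne le_sup_left fun h => ha ?_
  rw [h]
  exact Ideal.mem_sup_right (Ideal.mem_span_singleton_self a)

open MvPolynomial in
theorem aux_main {n : ℕ} (e : ℕ) (I : Ideal (MvPolynomial (Fin n) ℚ)) :
    ringKrullDim (MvPolynomial (Fin n) ℚ ⧸ I) ≤ e →
    ∃ C : ℝ, 0 < C ∧ ∀ H : ℤ, 1 ≤ H → ((auxZ I H).ncard : ℝ) ≤ C * (H : ℝ) ^ e := by
  classical
  induction I using IsNoetherian.induction with
  | hgt I ih =>
  change Ideal (MvPolynomial (Fin n) ℚ) at I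
  intro hd
  have hpos : ∀ H : ℤ, 1 ≤ H → (0 : ℝ) < (H : ℝ) ^ e := fun H hH => by
    have : (1 : ℝ) ≤ H := by exact_mod_cast hH
    positivity
  by_cases htop : I = ⊤
  · refine ⟨1, one_pos, fun H hH => ?_⟩
    have : auxZ I H = ∅ := by
      ext x
      simp only [Set.mem_empty_iff_false, iff_false]
      intro hx
      have := hx.2 1 (by rw [htop]; trivial)
      simp at this
    rw [this]
    simpa using (hpos H hH).le
  by_cases hp : Ideal.IsPrime I
  · obtain ⟨ι, _, u, F, hc, hF⟩ := aux_struct n e (Ideal.Quotient.mkₐ ℚ I)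
      (Ideal.Quotient.mkₐ_surjective ℚ I) hd
    have hker : RingHom.ker (Ideal.Quotient.mkₐ ℚ I) = I := by
      ext f
      exact Ideal.Quotient.eq_zero_iff_mem
    rw [hker] at hF
    let c := ∏ j, rename u (F j).leadingCoeff
    have hcI : c ∉ I := by
      intro hmem
      obtain ⟨j, -, hj⟩ := (Ideal.IsPrime.prod_mem_iff).mp hmem
      exact (hF j).1 hj
    obtain ⟨C, hC, hb⟩ := ih _ (aux_lt hcI) (aux_mono le_sup_left hd)
    refine ⟨C + ((∏ j, (F j).natDegree : ℕ) * 3 ^ e : ℝ), by positivity, fun H hH => ?_⟩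
    let G := {x ∈ auxZ I H | eval (fun i => (x i : ℚ)) c ≠ 0}
    have hsub : auxZ I H ⊆ auxZ (I ⊔ Ideal.span {c}) H ∪ G := by
      intro x hx
      by_cases h0 : eval (fun i => (x i : ℚ)) c = 0
      · exact Or.inl (auxZ_sup hx h0)
      · exact Or.inr ⟨hx, h0⟩
    have hGf : G.Finite := (auxZ_finite I H).subset fun x hx => hx.1
    have hn : (auxZ I H).ncard ≤ (auxZ (I ⊔ Ideal.span {c}) H).ncard + G.ncard :=
      (Set.ncard_le_ncard hsub ((auxZ_finite _ H).union hGf)).trans (Set.ncard_union_le _ _)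
    have hg := aux_good u F hc H hH G (fun x hx => hx.1.1)
      (fun x hx j h0 => hx.2 (by
        rw [map_prod]
        exact Finset.prod_eq_zero (Finset.mem_univ j) h0))
      (fun x hx j => hx.1.2 _ (hF j).2)
    have hb' := hb H hH
    have hn' : ((auxZ I H).ncard : ℝ) ≤ (auxZ (I ⊔ Ideal.span {c}) H).ncard + G.ncard := by
      exact_mod_cast hn
    rw [add_mul]
    linarith
  · rw [Ideal.isPrime_iff] at hp
    push Not at hp
    obtain ⟨a, b, hab, ha, hb⟩ := hp htop
    obtain ⟨C1, hC1, h1⟩ := ih _ (aux_lt ha) (aux_mono le_sup_left hd)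
    obtain ⟨C2, hC2, h2⟩ := ih _ (aux_lt hb) (aux_mono le_sup_left hd)
    refine ⟨C1 + C2, by positivity, fun H hH => ?_⟩
    have hsub : auxZ I H ⊆ auxZ (I ⊔ Ideal.span {a}) H ∪ auxZ (I ⊔ Ideal.span {b}) H := by
      intro x hx
      have := hx.2 _ hab
      rw [map_mul, mul_eq_zero] at this
      exact this.imp (auxZ_sup hx) (auxZ_sup hx)
    have hn := (Set.ncard_le_ncard hsub ((auxZ_finite _ H).union (auxZ_finite _ H))).trans
      (Set.ncard_union_le _ _)
    have hn' : ((auxZ I H).ncard : ℝ) ≤ (auxZ (I ⊔ Ideal.span {a}) H).ncard +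
        (auxZ (I ⊔ Ideal.span {b}) H).ncard := by
      exact_mod_cast hn
    have := h1 H hH
    have := h2 H hH
    rw [add_mul]
    linarith


/-- Counting integer points of bounded height on a variety defined over `ℤ`:
if the ideal generated by the rationalizations of `P_1, …, P_m` in `ℚ[x_1, …, x_n]`
cuts out a quotient ring of Krull dimension `e`, then the number of integer points of
height at most `H` on the common zero locus is `O(H ^ e)`. -/
theorem integer_points_bound (n m : ℕ) (P : Fin m → MvPolynomial (Fin n) ℤ) (e : ℕ)
    (hdim : ringKrullDim
      (MvPolynomial (Fin n) ℚ ⧸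
        Ideal.span (Set.range fun i => MvPolynomial.map (Int.castRingHom ℚ) (P i))) = e) :
    ∃ C : ℝ, 0 < C ∧
      ∀ H : ℤ, 1 ≤ H →
        (Set.ncard {x : Fin n → ℤ |
            (∀ i, |x i| ≤ H) ∧ ∀ i, MvPolynomial.eval x (P i) = 0} : ℝ) ≤
          C * (H : ℝ) ^ e := by
  obtain ⟨C, hC, h⟩ := aux_main e _ hdim.le
  refine ⟨C, hC, fun H hH => le_trans ?_ (h H hH)⟩
  have hsub : {x : Fin n → ℤ | (∀ i, |x i| ≤ H) ∧ ∀ i, MvPolynomial.eval x (P i) = 0} ⊆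
      auxZ (Ideal.span (Set.range fun i => MvPolynomial.map (Int.castRingHom ℚ) (P i))) H := by
    intro x hx
    refine ⟨hx.1, ?_⟩
    have : Ideal.span (Set.range fun i => MvPolynomial.map (Int.castRingHom ℚ) (P i)) ≤
        RingHom.ker (MvPolynomial.eval (fun i => (x i : ℚ))) := by
      rw [Ideal.span_le]
      rintro _ ⟨i, rfl⟩
      have h0 := congrArg (Int.castRingHom ℚ) (hx.2 i)
      rw [SetLike.mem_coe, RingHom.mem_ker, MvPolynomial.eval_map]
      rw [MvPolynomial.eval, MvPolynomial.coe_eval₂Hom, MvPolynomial.eval₂_comp_left] at h0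
      simpa [Function.comp_def] using h0
    exact fun f hf => this hf
  exact_mod_cast Set.ncard_le_ncard hsub (auxZ_finite _ H)
end

section
/- Fix an integer d ≥ 2. There exists a constant C > 0 such that for every integer N ≥ 2, the number of monic polynomials p ∈ ℤ[X] with natDegree p = d, constant coefficient p.coeff 0 = 1, and |p.coeff i| ≤ N for all i < d, such that the image of p in ℚ[X] is not irreducible, is at most C · N^{d-2}. -/
open Polynomial in
lemma aux_coeff_bound (d N : ℕ) (hN : 1 ≤ N) (q r : ℤ[X]) (hq : q.Monic) (hr : r.Monic)
    (hdeg : (q * r).natDegree = d) (hc : ∀ i < d, |(q * r).coeff i| ≤ (N : ℤ)) (i : ℕ) :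
    |q.coeff i| ≤ ((2 ^ d * (d + 1) * N : ℕ) : ℤ) := by
  set φ := Int.castRingHom ℂ
  have hm : (q * r).Monic := hq.mul hr
  have hall : ∀ i, ‖((q * r).map φ).coeff i‖ ≤ N := by
    intro i
    have : |(q * r).coeff i| ≤ (N : ℤ) := by
      rcases lt_trichotomy i d with h | h | h
      · exact hc i h
      · have : (q * r).coeff i = 1 := by rw [h, ← hdeg]; exact hm
        rw [this]; simp; omega
      · rw [coeff_eq_zero_of_natDegree_lt (by omega)]; simp
    rw [coeff_map]
    simp only [φ, eq_intCast, Complex.norm_intCast]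
    exact_mod_cast this
  have h1 : ((q * r).map φ).mahlerMeasure ≤ (d + 1) * N := by
    refine (mahlerMeasure_le_sum_norm_coeff _).trans ?_
    rw [sum_over_range _ (by simp)]
    refine (Finset.sum_le_card_nsmul _ _ (N : ℝ) fun i _ => hall i).trans ?_
    rw [Finset.card_range, hm.natDegree_map, hdeg]
    simp
  have h2 : 1 ≤ (r.map φ).mahlerMeasure := by
    apply one_le_mahlerMeasure_of_one_le_norm_leadingCoeff
    rw [(hr.map φ).leadingCoeff]; simp
  have h3 : (q.map φ).mahlerMeasure ≤ (d + 1) * N := by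
    rw [Polynomial.map_mul, mahlerMeasure_mul] at h1
    nlinarith [mahlerMeasure_nonneg (q.map φ)]
  have h4 := norm_coeff_le_choose_mul_mahlerMeasure i (q.map φ)
  have hqd : q.natDegree ≤ d := by
    rw [← hdeg, hq.natDegree_mul hr]; omega
  have h5 : ((q.map φ).natDegree.choose i : ℝ) ≤ 2 ^ d := by
    rw [hq.natDegree_map]
    exact_mod_cast (Nat.choose_le_two_pow _ _).trans (Nat.pow_le_pow_right (by norm_num) hqd)
  have h6 : ‖(q.map φ).coeff i‖ ≤ 2 ^ d * ((d + 1) * N) :=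
    h4.trans (mul_le_mul h5 h3 (mahlerMeasure_nonneg _) (by positivity))
  rw [coeff_map] at h6
  simp only [φ, eq_intCast, Complex.norm_intCast] at h6
  have : ((|q.coeff i| : ℤ) : ℝ) ≤ (((2 ^ d * (d + 1) * N : ℕ) : ℤ) : ℝ) := by
    push_cast; rw [mul_assoc]; exact h6
  exact_mod_cast this

/-- monic polynomials with unit constant term and bounded coefficients -/
def auxSet (k T : ℕ) : Set (Polynomial ℤ) :=
  {q | q.Monic ∧ q.natDegree = k ∧ |q.coeff 0| = 1 ∧ ∀ i, |q.coeff i| ≤ (T : ℤ)}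

lemma auxSet_finite_card (k T : ℕ) :
    (auxSet k T).Finite ∧ (auxSet k T).ncard ≤ 2 * (2 * T + 1) ^ (k - 1) := by
  classical
  let F : Finset (ℤ × (Fin (k - 1) → ℤ)) :=
    ({1, -1} : Finset ℤ) ×ˢ Fintype.piFinset (fun _ => Finset.Icc (-(T : ℤ)) T)
  let f : Polynomial ℤ → ℤ × (Fin (k - 1) → ℤ) := fun q => (q.coeff 0, fun i => q.coeff (i + 1))
  have hmaps : Set.MapsTo f (auxSet k T) (F : Set _) := by
    rintro q ⟨_, _, h0, hb⟩
    simp only [f, F, Finset.coe_product, Set.mem_prod, Finset.mem_coe, Fintype.mem_piFinset,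
      Finset.mem_Icc, Finset.mem_insert, Finset.mem_singleton]
    exact ⟨eq_or_eq_neg_of_abs_eq h0, fun i => abs_le.mp (hb _)⟩
  have hinj : Set.InjOn f (auxSet k T) := by
    rintro q ⟨hq, hqk, _, _⟩ r ⟨hr, hrk, _, _⟩ h
    simp only [f, Prod.mk.injEq] at h
    ext i
    rcases Nat.eq_zero_or_pos i with rfl | hi
    · exact h.1
    rcases lt_trichotomy i k with hik | hik | hik
    · have := congrFun h.2 ⟨i - 1, by omega⟩
      simpa [Nat.sub_add_cancel hi] using this
    · have h1 : q.coeff i = 1 := by rw [hik, ← hqk]; exact hq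
      have h2 : r.coeff i = 1 := by rw [hik, ← hrk]; exact hr
      rw [h1, h2]
    · rw [Polynomial.coeff_eq_zero_of_natDegree_lt (by omega),
        Polynomial.coeff_eq_zero_of_natDegree_lt (by omega)]
  refine ⟨Set.Finite.of_injOn hmaps hinj F.finite_toSet, ?_⟩
  refine (Set.ncard_le_ncard_of_injOn f hmaps hinj F.finite_toSet).trans ?_
  rw [Set.ncard_coe_finset]
  simp only [F, Finset.card_product, Fintype.card_piFinset, Int.card_Icc, Finset.prod_const,
    Finset.card_univ, Fintype.card_fin]
  have : ((T : ℤ) + 1 - -T).toNat = 2 * T + 1 := by omega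
  rw [this]
  simp

/-- The number of monic integer polynomials of degree `d ≥ 2` with constant term `1`
and all coefficients bounded by `N` that are reducible over `ℚ` is `O(N ^ (d - 2))`. -/
theorem reducible_constant_term_one_count (d : ℕ) (hd : 2 ≤ d) :
    ∃ C : ℝ, 0 < C ∧
      ∀ N : ℕ, 2 ≤ N →
        (Set.ncard {p : Polynomial ℤ |
            p.Monic ∧ p.natDegree = d ∧ p.coeff 0 = 1 ∧
            (∀ i < d, |p.coeff i| ≤ (N : ℤ)) ∧
            ¬ Irreducible (p.map (Int.castRingHom ℚ))} : ℝ) ≤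
          C * (N : ℝ) ^ (d - 2) := by
  classical
  refine ⟨d * (4 * (2 * (2 ^ d * (d + 1)) + 1) ^ (d - 2)), by positivity, ?_⟩
  intro N hN
  set T := 2 ^ d * (d + 1) * N with hT
  let A : ℕ → Finset (Polynomial ℤ) := fun k => (auxSet_finite_card k T).1.toFinset
  have hA : ∀ k, (A k).card ≤ 2 * (2 * T + 1) ^ (k - 1) := by
    intro k
    rw [← Set.ncard_eq_toFinset_card _ (auxSet_finite_card k T).1]
    exact (auxSet_finite_card k T).2
  let S : Finset (Polynomial ℤ) := (Finset.Ico 1 d).biUnion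
    fun k => Finset.image₂ (· * ·) (A k) (A (d - k))
  have hS : S.card ≤ d * (4 * (2 * T + 1) ^ (d - 2)) := by
    refine (Finset.card_biUnion_le_card_mul _ _ (4 * (2 * T + 1) ^ (d - 2)) ?_).trans ?_
    · intro k hk
      rw [Finset.mem_Ico] at hk
      refine (Finset.card_image₂_le _ _ _).trans ((Nat.mul_le_mul (hA k) (hA (d - k))).trans ?_)
      have : d - 2 = (k - 1) + (d - k - 1) := by omega
      rw [this, pow_add]
      apply le_of_eq; ring
    · apply Nat.mul_le_mul_right
      simp
  have hsub : {p : Polynomial ℤ |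
            p.Monic ∧ p.natDegree = d ∧ p.coeff 0 = 1 ∧
            (∀ i < d, |p.coeff i| ≤ (N : ℤ)) ∧
            ¬ Irreducible (p.map (Int.castRingHom ℚ))} ⊆ (S : Set (Polynomial ℤ)) := by
    rintro p ⟨hm, hpd, h0, hb, hirr⟩
    have hirr' : ¬ Irreducible p := fun h =>
      hirr ((hm.irreducible_iff_irreducible_map_fraction_map (K := ℚ)).1 h)
    rw [hm.irreducible_iff_natDegree'] at hirr'
    have hp1 : p ≠ 1 := by
      rintro rfl
      simp at hpd; omega
    push Not at hirr'
    obtain ⟨q, r, hq, hr, rfl, hdr⟩ := hirr' hp1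
    rw [Finset.mem_Ioc] at hdr
    have hsum := hq.natDegree_mul hr
    rw [Polynomial.mul_coeff_zero] at h0
    have hu : |q.coeff 0| = 1 := Int.isUnit_iff_abs_eq.mp (IsUnit.of_mul_eq_one _ h0)
    have hv : |r.coeff 0| = 1 :=
      Int.isUnit_iff_abs_eq.mp (IsUnit.of_mul_eq_one _ ((mul_comm _ _).trans h0))
    simp only [S, Finset.coe_biUnion, Set.mem_iUnion, Finset.mem_coe, Finset.mem_Ico]
    refine ⟨q.natDegree, by omega, Finset.mem_image₂.2 ⟨q, ?_, r, ?_, rfl⟩⟩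
    · simp only [A, Set.Finite.mem_toFinset]
      exact ⟨hq, rfl, hu, aux_coeff_bound d N (by omega) q r hq hr hpd hb⟩
    · simp only [A, Set.Finite.mem_toFinset]
      refine ⟨hr, by omega, hv, aux_coeff_bound d N (by omega) r q hr hq ?_ ?_⟩
      · rw [mul_comm, hpd]
      · rw [mul_comm]; exact hb
  have hcard := Set.ncard_le_ncard hsub S.finite_toSet
  rw [Set.ncard_coe_finset] at hcard
  have hT' : 2 * T + 1 ≤ (2 * (2 ^ d * (d + 1)) + 1) * N := by
    rw [hT]; nlinarith
  have hfin : S.card ≤ d * (4 * (2 * (2 ^ d * (d + 1)) + 1) ^ (d - 2)) * N ^ (d - 2) := by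
    refine hS.trans ?_
    rw [mul_assoc, mul_assoc, ← mul_pow]
    gcongr
  exact_mod_cast hcard.trans hfin
end

section
/- Fix an integer d ≥ 2. There exists a constant C > 0 such that for every integer N ≥ 2, the number of polynomials p ∈ P_d(N) such that the image of p in ℚ[X] is not irreducible is at most C · N^{d-1} · log N. Equivalently, a uniformly random monic integer polynomial of degree d with all coefficients in [-N, N] is reducible over ℚ with probability O(log N / N). -/
open Polynomial in
noncomputable def mkP (m : ℕ) (a : ℤ) (u : Fin m → ℤ) : Polynomial ℤ :=
  X ^ (m + 1) + ((∑ i : Fin m, C (u i) * X ^ ((i : ℕ) + 1)) + C a)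

noncomputable def boxF (m B : ℕ) : Finset (Fin m → ℤ) :=
  Fintype.piFinset (fun _ => Finset.Icc (-(B : ℤ)) B)

lemma card_boxF (m B : ℕ) : (boxF m B).card = (2 * B + 1) ^ m := by
  simp only [boxF, Fintype.card_piFinset_const, Int.card_Icc]
  congr 1
  omega

lemma mem_boxF (m B : ℕ) (u : Fin m → ℤ) : u ∈ boxF m B ↔ ∀ i, |u i| ≤ (B : ℤ) := by
  simp [boxF, abs_le]

lemma eq_mkP {q : Polynomial ℤ} (hq : q.Monic) (m : ℕ) (hm : q.natDegree = m + 1) :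
    q = mkP m (q.coeff 0) (fun i => q.coeff (i + 1)) := by
  conv_lhs => rw [hq.as_sum, hm]
  rw [mkP, Finset.sum_range_succ', Finset.sum_range]
  simp

def signF : Finset ℤ := {1, -1}

def hypF (N : ℕ) : Finset (Σ _ : ℕ, ℕ) :=
  (Finset.range N).sigma fun a => Finset.range (N / (a + 1))

lemma card_hypF (N : ℕ) : ((hypF N).card : ℝ) ≤ N * (1 + Real.log N) := by
  have h := harmonic_le_one_add_log N
  refine le_trans ?_ (mul_le_mul_of_nonneg_left h (Nat.cast_nonneg N))
  simp only [hypF, Finset.card_sigma, Finset.card_range, harmonic]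
  push_cast
  rw [Finset.mul_sum]
  refine Finset.sum_le_sum fun i _ => ?_
  have := @Nat.cast_div_le ℝ _ _ _ N (i + 1)
  push_cast at this
  rwa [div_eq_mul_inv] at this

noncomputable def facF (m n N B : ℕ) : Finset (Polynomial ℤ) :=
  ((signF ×ˢ signF) ×ˢ (hypF N ×ˢ (boxF m B ×ˢ boxF n B))).image
    (fun t => mkP m (t.1.1 * ((t.2.1.1 : ℤ) + 1)) t.2.2.1 *
      mkP n (t.1.2 * ((t.2.1.2 : ℤ) + 1)) t.2.2.2)

lemma card_facF (m n N B : ℕ) : ((facF m n N B).card : ℝ) ≤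
    4 * (N * (1 + Real.log N)) * (2 * B + 1) ^ (m + n) := by
  have h : (facF m n N B).card ≤ 4 * (hypF N).card * (2 * B + 1) ^ (m + n) := by
    refine Finset.card_image_le.trans (le_of_eq ?_)
    simp only [Finset.card_product, card_boxF]
    have : signF.card = 2 := by decide
    rw [this, pow_add]; ring
  have h2 : ((facF m n N B).card : ℝ) ≤ 4 * (hypF N).card * (2 * B + 1) ^ (m + n) := by
    exact_mod_cast h
  refine h2.trans ?_
  have := card_hypF N
  gcongr

lemma sign_form (x : ℤ) (hx : x ≠ 0) :
    ∃ s ∈ signF, x = s * (((x.natAbs - 1 : ℕ) : ℤ) + 1) := by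
  rcases lt_or_gt_of_ne hx with h | h
  · exact ⟨-1, by decide, by omega⟩
  · exact ⟨1, by decide, by omega⟩

lemma mem_facF (m n N B : ℕ) (q r : Polynomial ℤ) (hq : q.Monic) (hr : r.Monic)
    (hm : q.natDegree = m + 1) (hn : r.natDegree = n + 1)
    (h0 : q.coeff 0 * r.coeff 0 ≠ 0) (hN : |q.coeff 0 * r.coeff 0| ≤ (N : ℤ))
    (hqB : ∀ i, |q.coeff i| ≤ (B : ℤ)) (hrB : ∀ i, |r.coeff i| ≤ (B : ℤ)) :
    q * r ∈ facF m n N B := by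
  obtain ⟨s, hs, hs'⟩ := sign_form _ (left_ne_zero_of_mul h0)
  obtain ⟨t, ht, ht'⟩ := sign_form _ (right_ne_zero_of_mul h0)
  have ha : 0 < (q.coeff 0).natAbs := Int.natAbs_pos.2 (left_ne_zero_of_mul h0)
  have hb : 0 < (r.coeff 0).natAbs := Int.natAbs_pos.2 (right_ne_zero_of_mul h0)
  have hab : (q.coeff 0).natAbs * (r.coeff 0).natAbs ≤ N := by
    rw [← Int.natAbs_mul]; zify; exact hN
  refine Finset.mem_image.2 ⟨((s, t), (⟨(q.coeff 0).natAbs - 1, (r.coeff 0).natAbs - 1⟩,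
    (fun i => q.coeff (i + 1), fun i => r.coeff (i + 1)))), ?_, ?_⟩
  · simp only [Finset.mem_product, mem_boxF, hypF, Finset.mem_sigma, Finset.mem_range]
    refine ⟨⟨hs, ht⟩, ⟨?_, ?_⟩, fun i => hqB _, fun i => hrB _⟩
    · have := Nat.le_mul_of_pos_right (q.coeff 0).natAbs hb
      omega
    · rw [Nat.sub_add_cancel ha]
      have : (r.coeff 0).natAbs ≤ N / (q.coeff 0).natAbs :=
        (Nat.le_div_iff_mul_le ha).2 (by rw [mul_comm]; exact hab)
      exact lt_of_lt_of_le (Nat.sub_lt hb one_pos) this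
  · simp only
    rw [← hs', ← ht', ← eq_mkP hq m hm, ← eq_mkP hr n hn]

lemma factor_bound (d N : ℕ) (hN : 1 ≤ N) (p q r : Polynomial ℤ) (hp : p.Monic)
    (hd : p.natDegree = d)
    (hc : ∀ i < d, |p.coeff i| ≤ (N : ℤ)) (hq : q.Monic) (hr : r.Monic) (h : q * r = p) (i : ℕ) :
    |q.coeff i| ≤ ((2 ^ d * (d + 1) * N : ℕ) : ℤ) := by
  have hv : Isometry (Int.castRingHom ℂ) := by
    refine AddMonoidHomClass.isometry_of_norm _ fun x => ?_
    simp [Int.norm_eq_abs]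
  have h1 := Polynomial.norm_coeff_le_choose_mul_mapMahlerMeasure _ hv i q
  have h2 : p.mapMahlerMeasure (Int.castRingHom ℂ) ≤ (d + 1) * N := by
    refine (Polynomial.mapMahlerMeasure_le_sum_norm_coeff _ _ hv).trans ?_
    rw [Polynomial.sum_over_range _ (by simp), hd]
    refine (Finset.sum_le_card_nsmul _ _ (N : ℝ) fun j hj => ?_).trans (le_of_eq (by simp))
    rcases (Nat.lt_succ_iff.1 (Finset.mem_range.1 hj)).lt_or_eq with hj | hj
    · rw [Int.norm_eq_abs]; exact_mod_cast hc j hj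
    · rw [hj, ← hd, hp.coeff_natDegree]; simpa using hN
  have h3 := hr.one_le_mapMahlerMeasure _ hv
  have h4 : q.mapMahlerMeasure (Int.castRingHom ℂ) ≤ (d + 1) * N := by
    rw [← h, Polynomial.mapMahlerMeasure_mul] at h2
    exact (le_mul_of_one_le_right (Polynomial.mapMahlerMeasure_nonneg _ _) h3).trans h2
  have hqd : q.natDegree ≤ d := by
    rw [← hd, ← h, hq.natDegree_mul hr]; omega
  have h5 : (q.natDegree.choose i : ℝ) ≤ 2 ^ d := by
    have := (Nat.choose_le_two_pow q.natDegree i).trans (Nat.pow_le_pow_right (by norm_num) hqd)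
    exact_mod_cast this
  have h6 : ‖q.coeff i‖ ≤ 2 ^ d * ((d + 1) * N) := by
    refine h1.trans ?_
    have := Polynomial.mapMahlerMeasure_nonneg q (Int.castRingHom ℂ)
    gcongr
  rw [Int.norm_eq_abs, ← mul_assoc] at h6
  exact_mod_cast h6

noncomputable def allF (e N B : ℕ) : Finset (Polynomial ℤ) :=
  (boxF (e + 1) N).image (mkP (e + 1) 0) ∪
    (Finset.range (e + 1)).biUnion (fun m => facF m (e - m) N B)

lemma card_allF (e N B : ℕ) : ((allF e N B).card : ℝ) ≤
    (2 * N + 1) ^ (e + 1) + (e + 1) * (4 * (N * (1 + Real.log N)) * (2 * B + 1) ^ e) := by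
  have h1 : (allF e N B).card ≤ (2 * N + 1) ^ (e + 1) +
      ∑ m ∈ Finset.range (e + 1), (facF m (e - m) N B).card := by
    refine (Finset.card_union_le _ _).trans (add_le_add ?_ Finset.card_biUnion_le)
    exact Finset.card_image_le.trans (card_boxF _ _).le
  have h2 : ((allF e N B).card : ℝ) ≤ (2 * N + 1) ^ (e + 1) +
      ∑ m ∈ Finset.range (e + 1), ((facF m (e - m) N B).card : ℝ) := by
    exact_mod_cast h1
  refine h2.trans (add_le_add le_rfl ?_)
  refine (Finset.sum_le_card_nsmul _ _ (4 * (N * (1 + Real.log N)) * (2 * B + 1) ^ e)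
    fun m hm => ?_).trans (le_of_eq ?_)
  · have := card_facF m (e - m) N B
    rwa [Nat.add_sub_cancel' (Nat.lt_succ_iff.1 (Finset.mem_range.1 hm))] at this
  · simp

lemma mem_allF (e N : ℕ) (hN : 1 ≤ N) (p : Polynomial ℤ) (hp : p.Monic)
    (hd : p.natDegree = e + 2) (hc : ∀ i < e + 2, |p.coeff i| ≤ (N : ℤ))
    (hirr : ¬ Irreducible (p.map (Int.castRingHom ℚ))) :
    p ∈ allF e N (2 ^ (e + 2) * ((e + 2 : ℕ) + 1) * N) := by
  by_cases h0 : p.coeff 0 = 0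
  · refine Finset.mem_union_left _ (Finset.mem_image.2 ⟨fun i => p.coeff (i + 1), ?_, ?_⟩)
    · rw [mem_boxF]
      exact fun i => hc _ (by omega)
    · have := eq_mkP hp (e + 1) hd
      rw [h0] at this
      exact this.symm
  · have hirr' : ¬ Irreducible p := fun h =>
      hirr ((hp.irreducible_iff_irreducible_map_fraction_map (K := ℚ)).1 h)
    have hp1 : p ≠ 1 := by rintro rfl; simp at hd
    rw [hp.irreducible_iff_natDegree] at hirr'
    push Not at hirr'
    replace hirr' := hirr' hp1
    obtain ⟨q, r, hq, hr, hqr, hq0, hr0⟩ := hirr'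
    have hdeg : q.natDegree + r.natDegree = e + 2 := by
      rw [← hq.natDegree_mul hr, hqr, hd]
    have hcc : q.coeff 0 * r.coeff 0 = p.coeff 0 := by
      rw [← hqr, Polynomial.mul_coeff_zero]
    refine Finset.mem_union_right _ (Finset.mem_biUnion.2
      ⟨q.natDegree - 1, Finset.mem_range.2 (by omega), ?_⟩)
    rw [← hqr]
    refine mem_facF _ _ _ _ q r hq hr (by omega) (by omega) (by rwa [hcc])
      (by rw [hcc]; exact hc 0 (by omega)) (fun i => ?_) (fun i => ?_)
    · exact factor_bound _ N hN p q r hp hd hc hq hr hqr i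
    · exact factor_bound _ N hN p r q hp hd hc hr hq (by rw [mul_comm, hqr]) i

/-- The number of monic integer polynomials of degree `d ≥ 2` with all coefficients
bounded by `N` that are reducible over `ℚ` is `O(N ^ (d - 1) * log N)`; equivalently,
a random polynomial in `P_d(N)` is reducible over `ℚ` with probability `O(log N / N)`. -/
theorem reducible_count (d : ℕ) (hd : 2 ≤ d) :
    ∃ C : ℝ, 0 < C ∧
      ∀ N : ℕ, 2 ≤ N →
        (Set.ncard {p : Polynomial ℤ |
            p.Monic ∧ p.natDegree = d ∧
            (∀ i < d, |p.coeff i| ≤ (N : ℤ)) ∧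
            ¬ Irreducible (p.map (Int.castRingHom ℚ))} : ℝ) ≤
          C * (N : ℝ) ^ (d - 1) * Real.log N := by
  obtain ⟨e, rfl⟩ := Nat.exists_eq_add_of_le' hd
  set K : ℕ := 2 ^ (e + 2) * ((e + 2 : ℕ) + 1) with hK
  have hK1 : 1 ≤ K := Nat.succ_le_of_lt (by positivity)
  refine ⟨3 ^ (e + 1) * 2 + (e + 1) * (4 * 3 * (3 * K) ^ e), by positivity, fun N hN => ?_⟩
  have hsub : {p : Polynomial ℤ | p.Monic ∧ p.natDegree = e + 2 ∧
      (∀ i < e + 2, |p.coeff i| ≤ (N : ℤ)) ∧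
      ¬ Irreducible (p.map (Int.castRingHom ℚ))} ⊆ (allF e N (K * N) : Set (Polynomial ℤ)) := by
    rintro p ⟨hp, hpd, hc, hi⟩
    exact mem_allF e N (by omega) p hp hpd hc hi
  have h1 := Set.ncard_le_ncard hsub (Finset.finite_toSet _)
  rw [Set.ncard_coe_finset] at h1
  have h2 : ((allF e N (K * N)).card : ℝ) ≤ _ := card_allF e N (K * N)
  refine (Nat.cast_le.2 h1).trans (h2.trans ?_)
  have hN' : (1 : ℝ) ≤ N := by exact_mod_cast (by omega : 1 ≤ N)
  have hKN : (1 : ℝ) ≤ K * N := by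
    exact_mod_cast Nat.succ_le_of_lt (Nat.mul_pos hK1 (by omega))
  have hlog : 1 ≤ 2 * Real.log N := by
    have h3 : Real.log 2 ≤ Real.log N :=
      Real.log_le_log (by norm_num) (by exact_mod_cast hN)
    have := Real.log_two_gt_d9
    linarith
  have hl0 : 0 ≤ Real.log N := by linarith
  push_cast
  calc (2 * (N : ℝ) + 1) ^ (e + 1) +
        (e + 1) * (4 * (N * (1 + Real.log N)) * (2 * (K * N) + 1) ^ e)
      ≤ (3 * (N : ℝ)) ^ (e + 1) * (2 * Real.log N) +
        (e + 1) * (4 * (N * (3 * Real.log N)) * (3 * (K * N)) ^ e) := by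
        have a1 : (2 * (N : ℝ) + 1) ^ (e + 1) ≤ (3 * (N : ℝ)) ^ (e + 1) * (2 * Real.log N) := by
          refine le_trans ?_ (le_mul_of_one_le_right (by positivity) hlog)
          gcongr
          linarith
        have a2 : (2 * ((K : ℝ) * N) + 1) ^ e ≤ (3 * (K * N)) ^ e := by
          gcongr
          linarith
        have a3 : 1 + Real.log N ≤ 3 * Real.log N := by linarith
        gcongr
    _ = _ := by
        simp only [mul_pow, pow_succ]
        ring
end

section
/- Let p ∈ ℚ[X] be monic of degree n with n distinct complex roots (Fintype.card (p.rootSet ℂ) = n), let 1 ≤ k ≤ n, and suppose the products ∏_{r ∈ S} r over k-element subsets S of p.rootSet ℂ are pairwise distinct. Let q ∈ ℚ[X] be a polynomial whose image under the algebra map ℚ → ℂ equals ∏_S (X - ∏_{r ∈ S} r), the product over all subsets S of p.rootSet ℂ of cardinality k, and suppose q is irreducible over ℚ. Then the Galois group of p is k-homogeneous: for any two subsets S, T of p.rootSet ℂ of cardinality k there exists g ∈ Gal(p) with (galActionHom p ℂ g) '' S = T. -/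
open Polynomial Polynomial.Gal

attribute [local instance] Polynomial.Gal.splits_ℚ_ℂ

open scoped Classical

theorem aux_homogeneous {F E : Type*} [Field F] [Field E] [Algebra F E] (p : F[X])
    [Fact ((p.map (algebraMap F E)).Splits)] (k : ℕ)
    (hdist : ∀ S ∈ (Finset.univ : Finset (p.rootSet E)).powersetCard k,
      ∀ T ∈ (Finset.univ : Finset (p.rootSet E)).powersetCard k,
        (∏ r ∈ S, (r : E)) = (∏ r ∈ T, (r : E)) → S = T)
    (q : F[X])
    (hq : q.map (algebraMap F E) =
      ∏ S ∈ (Finset.univ : Finset (p.rootSet E)).powersetCard k,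
        (X - C (∏ r ∈ S, (r : E))))
    (hirr : Irreducible q) :
    ∀ S T : Finset (p.rootSet E), S.card = k → T.card = k →
      ∃ g : p.Gal, (fun x => galActionHom p E g x) '' (S : Set (p.rootSet E)) = T := by
  have hcoe : ∀ x : p.rootSet p.SplittingField,
      ((rootsEquivRoots p E x : p.rootSet E) : E) = algebraMap p.SplittingField E x :=
    fun x => rfl
  have hsym : ∀ r : p.rootSet E,
      algebraMap p.SplittingField E ((rootsEquivRoots p E).symm r) = (r : E) := by
    intro r
    refine (hcoe _).symm.trans ?_
    rw [Equiv.apply_symm_apply]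
  have hprod : ∀ S : Finset (p.rootSet E),
      algebraMap p.SplittingField E
        (∏ r ∈ S, ((rootsEquivRoots p E).symm r : p.SplittingField)) = ∏ r ∈ S, (r : E) := by
    intro S
    rw [map_prod]
    exact Finset.prod_congr rfl fun r _ => hsym r
  have hroot : ∀ S : Finset (p.rootSet E), S.card = k →
      aeval (∏ r ∈ S, ((rootsEquivRoots p E).symm r : p.SplittingField)) q = 0 := by
    intro S hS
    apply (algebraMap p.SplittingField E).injective
    rw [map_zero, ← aeval_algebraMap_apply, hprod, aeval_def, eval₂_eq_eval_map, hq, eval_prod]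
    apply Finset.prod_eq_zero (i := S)
    · simp [Finset.mem_powersetCard, hS]
    · rw [eval_sub, eval_X, eval_C, sub_self]
  intro S T hS hT
  have h1 := minpoly.eq_of_irreducible hirr (hroot S hS)
  have h2 := minpoly.eq_of_irreducible hirr (hroot T hT)
  obtain ⟨g, hg⟩ := (Normal.minpoly_eq_iff_mem_orbit p.SplittingField).mp (h2.symm.trans h1)
  let g' : p.Gal := g
  have hact : ∀ r : p.rootSet E, ((galActionHom p E g' r : p.rootSet E) : E)
      = algebraMap p.SplittingField E (g ((rootsEquivRoots p E).symm r)) := fun r => rfl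
  refine ⟨g', ?_⟩
  have key : S.map (galActionHom p E g').toEmbedding = T := by
    apply hdist
    · simp [Finset.mem_powersetCard, hS]
    · simp [Finset.mem_powersetCard, hT]
    · rw [Finset.prod_map, ← hprod T, ← hg]
      change _ = algebraMap p.SplittingField E (g (∏ r ∈ S, _))
      rw [map_prod, map_prod]
      exact Finset.prod_congr rfl fun r _ => hact r
  rw [← key, Finset.coe_map]
  rfl

/-- If `p ∈ ℚ[X]` is monic of degree `n` with `n` distinct complex roots whose products
over `k`-element subsets are pairwise distinct, and the resolvent polynomial `q` whose
complex roots are these products is irreducible over `ℚ`, then the Galois group of `p`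
is `k`-homogeneous: it acts transitively on the `k`-element subsets of the roots. -/
theorem k_homogeneous_of_resolvent_irreducible (p : ℚ[X]) (n : ℕ)
    (hp : p.Monic) (hdeg : p.natDegree = n)
    (hcard : Fintype.card (p.rootSet ℂ) = n)
    (k : ℕ) (hk : 1 ≤ k) (hkn : k ≤ n)
    (hdist : ∀ S ∈ (Finset.univ : Finset (p.rootSet ℂ)).powersetCard k,
      ∀ T ∈ (Finset.univ : Finset (p.rootSet ℂ)).powersetCard k,
        (∏ r ∈ S, (r : ℂ)) = (∏ r ∈ T, (r : ℂ)) → S = T)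
    (q : ℚ[X])
    (hq : q.map (algebraMap ℚ ℂ) =
      ∏ S ∈ (Finset.univ : Finset (p.rootSet ℂ)).powersetCard k,
        (X - C (∏ r ∈ S, (r : ℂ))))
    (hirr : Irreducible q) :
    ∀ S T : Finset (p.rootSet ℂ), S.card = k → T.card = k →
      ∃ g : p.Gal, (fun x => galActionHom p ℂ g x) '' (S : Set (p.rootSet ℂ)) = T := by
  exact aux_homogeneous p k hdist q hq hirr
end
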